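/- arXiv:2511.03296 — 7 statements merged into one kernel-verified Lean document; each statement's English description precedes it below -/
import Mathlib

section
/- Suppose f satisfies (A1) and Behavior (B1) holds with limit point x̄ and search directions p^k = −H_k ∇f(x^k). Then for every i ∈ {2,…,m}, lim_{k→∞} ( ∇f_i(x^k)ᵀ p^k − ∇f_1(x^k)ᵀ p^k ) = 0. -/
open Filter Topology Matrix RealInnerProductSpace

noncomputable section

/-- Euclidean space ℝ^n. -/
abbrev Euc (n : ℕ) := EuclideanSpace ℝ (Fin n)

/-- Assumption (A1): `f` is a continuous selection of the `C¹` functions `φ i`,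
whose gradients are locally Lipschitz continuous. -/
def A1 {n m : ℕ} (f : Euc n → ℝ) (φ : Fin m → Euc n → ℝ) : Prop :=
  Continuous f ∧ (∀ x, ∃ i, f x = φ i x) ∧
    ∀ i, ContDiff ℝ 1 (φ i) ∧ LocallyLipschitz (gradient (φ i))

/-- The essentially active set `I_e(x)`. -/
def Ie {n m : ℕ} (f : Euc n → ℝ) (φ : Fin m → Euc n → ℝ) (x : Euc n) : Set (Fin m) :=
  {i | x ∈ closure (interior {y | f y = φ i y})}

/-- The set `I_g(x)` of essentially active indices whose gradient coincides with `∇f(x)`. -/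
def Ig {n m : ℕ} (f : Euc n → ℝ) (φ : Fin m → Euc n → ℝ) (x : Euc n) : Set (Fin m) :=
  {i | i ∈ Ie f φ x ∧ gradient f x = gradient (φ i) x}

/-- The space `N(x̄) = span{∇f_i(x̄) − ∇f_1(x̄) : i ∈ I}`. -/
def NSpace {n m : ℕ} [NeZero m] (φ : Fin m → Euc n → ℝ) (x : Euc n) : Submodule ℝ (Euc n) :=
  Submodule.span ℝ (Set.range fun i : Fin m => gradient (φ i) x - gradient (φ 0) x)

/-- `t` satisfies the Wolfe conditions at `x` in direction `p`. -/
def WolfeStep {n : ℕ} (f : Euc n → ℝ) (c1 c2 : ℝ) (x p : Euc n) (t : ℝ) : Prop :=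
  DifferentiableAt ℝ f (x + t • p) ∧
  f (x + t • p) ≤ f x + c1 * t * ⟪gradient f x, p⟫ ∧
  c2 * ⟪gradient f x, p⟫ ≤ ⟪gradient f (x + t • p), p⟫

/-- Behavior (B1). -/
def B1 {n m : ℕ} [NeZero m] (f : Euc n → ℝ) (φ : Fin m → Euc n → ℝ) (c1 c2 : ℝ)
    (x : ℕ → Euc n) (H : ℕ → Matrix (Fin n) (Fin n) ℝ) (t : ℕ → ℝ) (xbar : Euc n) : Prop :=
  (0 < c1 ∧ c1 < c2 ∧ c2 < 1) ∧
  (∀ k, (H k).IsSymm ∧ (H k).PosDef) ∧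
  (∀ k, x (k+1) = x k + t k • (-(Matrix.toEuclideanLin (H k) (gradient f (x k))))) ∧
  (∀ k, 0 < t k ∧
    WolfeStep f c1 c2 (x k) (-(Matrix.toEuclideanLin (H k) (gradient f (x k)))) (t k)) ∧
  (∀ k, DifferentiableAt ℝ f (x k) ∧ gradient f (x k) ≠ 0) ∧
  Tendsto x atTop (𝓝 xbar) ∧
  (∀ i : Fin m, {k | i ∈ Ig f φ (x k)}.Infinite) ∧
  (∃ σL σU : ℝ, 0 < σL ∧ σL ≤ σU ∧ ∀ k,
    (∀ v : Euc n, ⟪v, Matrix.toEuclideanLin (H k) v⟫ ≤ σU * ‖v‖ ^ 2) ∧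
    (∃ W : Submodule ℝ (Euc n),
      Module.finrank ℝ W = n - Module.finrank ℝ (NSpace φ xbar) ∧
      ∀ v ∈ W, σL * ‖v‖ ^ 2 ≤ ⟪v, Matrix.toEuclideanLin (H k) v⟫)) ∧
  (∀ i : Fin m, Tendsto
    (fun k => Matrix.toEuclideanLin (H k) (gradient (φ i) xbar - gradient (φ 0) xbar))
    atTop (𝓝 0))

/-- At a point of differentiability, the gradient of a selection of finitely many differentiable
functions is at most as long as the gradient of one of these functions. -/
lemma exists_norm_gradient_le {E ι : Type*} [NormedAddCommGroup E] [InnerProductSpace ℝ E]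
    [CompleteSpace E] [Finite ι] {f : E → ℝ} {φ : ι → E → ℝ} (hsel : ∀ y, ∃ i, f y = φ i y)
    {x : E} (hf : DifferentiableAt ℝ f x) (hφ : ∀ i, DifferentiableAt ℝ (φ i) x) :
    ∃ i, ‖gradient f x‖ ≤ ‖gradient (φ i) x‖ := by
  by_contra! hlt
  have hline : ∀ {g : E → ℝ}, DifferentiableAt ℝ g x →
      HasDerivAt (fun s : ℝ => g (x + s • gradient f x)) ⟪gradient g x, gradient f x⟫ 0 := by
    intro g hg
    have hl : HasDerivAt (fun s : ℝ => x + s • gradient f x) (gradient f x) 0 := by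
      simpa using ((hasDerivAt_id (0 : ℝ)).smul_const (gradient f x)).const_add x
    have hg' : HasFDerivAt g (InnerProductSpace.toDual ℝ E (gradient g x))
        (x + (0 : ℝ) • gradient f x) := by
      simpa using hg.hasGradientAt.hasFDerivAt
    have h := hg'.comp_hasDerivAt (0 : ℝ) hl
    rwa [InnerProductSpace.toDual_apply_apply] at h
  have hne : ∀ i, ∀ᶠ s in 𝓝[≠] (0 : ℝ),
      f (x + s • gradient f x) - φ i (x + s • gradient f x) ≠ 0 := by
    intro i
    refine ((hline hf).sub (hline (hφ i))).eventually_ne (c := 0) ?_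
    have hpos : 0 < ‖gradient f x‖ := (norm_nonneg _).trans_lt (hlt i)
    have hcs := real_inner_le_norm (gradient (φ i) x) (gradient f x)
    rw [real_inner_self_eq_norm_mul_norm]
    have := mul_lt_mul_of_pos_right (hlt i) hpos
    linarith
  obtain ⟨s, hs⟩ := (eventually_all.2 hne).exists
  obtain ⟨i, hi⟩ := hsel (x + s • gradient f x)
  exact hs i (sub_eq_zero.2 hi)

/-- A positive symmetric operator whose quadratic form is bounded by `σ * ‖v‖ ^ 2` has operator
norm at most `σ`. -/
lemma norm_apply_le_of_inner_le {E : Type*} [NormedAddCommGroup E] [InnerProductSpace ℝ E]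
    {T : E →ₗ[ℝ] E} (hT : T.IsPositive) {σ : ℝ} (hσ : 0 < σ)
    (hub : ∀ v, ⟪v, T v⟫ ≤ σ * ‖v‖ ^ 2) (v : E) : ‖T v‖ ≤ σ * ‖v‖ := by
  have hnn : 0 ≤ ⟪σ • v - T v, T (σ • v - T v)⟫ := by
    simpa using hT.inner_nonneg_right (σ • v - T v)
  have hsymm : ⟪v, T (T v)⟫ = ‖T v‖ ^ 2 := by
    rw [← hT.isSymmetric v (T v), real_inner_self_eq_norm_sq]
  simp only [map_sub, map_smul, inner_sub_left, inner_sub_right, real_inner_smul_left,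
    real_inner_smul_right, hsymm, real_inner_self_eq_norm_sq] at hnn
  have h1 := hub (T v)
  have h2 := hub v
  refine (sq_le_sq₀ (norm_nonneg _) (by positivity)).1 ?_
  have h3 : σ * ‖T v‖ ^ 2 ≤ σ * (σ * ⟪v, T v⟫) := by nlinarith
  have h4 := le_of_mul_le_mul_left h3 hσ
  nlinarith

/-- Lemma `lem:common_descent`: under (A1) and Behavior (B1), for every
`i ∈ {2,…,m}` we have `∇f_i(x^k)ᵀ p^k − ∇f_1(x^k)ᵀ p^k → 0` where
`p^k = −H_k ∇f(x^k)`. -/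
theorem common_descent {n m : ℕ} [NeZero m] (f : Euc n → ℝ) (φ : Fin m → Euc n → ℝ)
    (c1 c2 : ℝ) (x : ℕ → Euc n) (H : ℕ → Matrix (Fin n) (Fin n) ℝ) (t : ℕ → ℝ)
    (xbar : Euc n) (hA1 : A1 f φ) (hB1 : B1 f φ c1 c2 x H t xbar) :
    ∀ i : Fin m, i ≠ 0 →
      Tendsto (fun k =>
          ⟪gradient (φ i) (x k), -(Matrix.toEuclideanLin (H k) (gradient f (x k)))⟫ -
          ⟪gradient (φ 0) (x k), -(Matrix.toEuclideanLin (H k) (gradient f (x k)))⟫)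
        atTop (𝓝 0) := by
  obtain ⟨-, hsel, hφ⟩ := hA1
  obtain ⟨-, hH, -, -, hdiff, hx, -, ⟨σL, σ, hσL, hLU, hb⟩, hker⟩ := hB1
  intro i _
  have hσ : 0 < σ := hσL.trans_le hLU
  have hpos : ∀ k, (Matrix.toEuclideanLin (H k)).IsPositive := fun k =>
    Matrix.isPositive_toEuclideanLin_iff.2 (hH k).2.posSemidef
  have hgrad : ∀ j, Tendsto (fun k => gradient (φ j) (x k)) atTop (𝓝 (gradient (φ j) xbar)) :=
    fun j => ((hφ j).2.continuous.tendsto xbar).comp hx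
  set G : ℕ → ℝ := fun k => ∑ j, ‖gradient (φ j) (x k)‖
  have hG : Tendsto G atTop (𝓝 (∑ j, ‖gradient (φ j) xbar‖)) :=
    tendsto_finsetSum _ fun j _ => (hgrad j).norm
  have hfG : ∀ k, ‖gradient f (x k)‖ ≤ G k := by
    intro k
    obtain ⟨j, hj⟩ := exists_norm_gradient_le hsel (hdiff k).1
      fun j => ((hφ j).1.differentiable one_ne_zero) (x k)
    exact hj.trans (Finset.single_le_sum (f := fun j => ‖gradient (φ j) (x k)‖)
      (fun _ _ => norm_nonneg _) (Finset.mem_univ j))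
  set d : Euc n := gradient (φ i) xbar - gradient (φ 0) xbar with hd
  set e : ℕ → Euc n := fun k => gradient (φ i) (x k) - gradient (φ 0) (x k) - d with he
  have he0 : Tendsto (fun k => ‖e k‖) atTop (𝓝 0) := by
    simpa [he, hd] using (((hgrad i).sub (hgrad 0)).sub_const d).norm
  have hd0 : Tendsto (fun k => ‖Matrix.toEuclideanLin (H k) d‖) atTop (𝓝 0) := by
    simpa only [norm_zero] using (hker i).norm
  refine squeeze_zero_norm (a := fun k =>
    ‖e k‖ * (σ * G k) + ‖Matrix.toEuclideanLin (H k) d‖ * G k) (fun k => ?_) ?_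
  · have hsplit : ⟪gradient (φ i) (x k), -(Matrix.toEuclideanLin (H k) (gradient f (x k)))⟫ -
        ⟪gradient (φ 0) (x k), -(Matrix.toEuclideanLin (H k) (gradient f (x k)))⟫ =
        -(⟪e k, Matrix.toEuclideanLin (H k) (gradient f (x k))⟫ +
          ⟪Matrix.toEuclideanLin (H k) d, gradient f (x k)⟫) := by
      rw [(hpos k).isSymmetric d (gradient f (x k))]
      simp only [he, inner_sub_left, inner_neg_right]
      ring
    rw [hsplit, norm_neg]
    refine (norm_add_le _ _).trans (add_le_add ?_ ?_)
    · refine (norm_inner_le_norm _ _).trans ?_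
      gcongr
      refine (norm_apply_le_of_inner_le (hpos k) hσ (hb k).1 _).trans ?_
      gcongr
      exact hfG k
    · refine (norm_inner_le_norm _ _).trans ?_
      gcongr
      exact hfG k
  · simpa using (he0.mul (hG.const_mul σ)).add (hd0.mul hG)
end
end

section
/- Suppose f satisfies (A1). Let x ∉ Ω, c₂ ∈ (0,1), and p ∈ ℝ^n with ∇f(x)ᵀp < 0. Let t > 0 be a step length with x + tp ∉ Ω satisfying the curvature condition ∇f(x + tp)ᵀp ≥ c₂ ∇f(x)ᵀp. Let i ∈ I_g(x + tp) and let L > 0 be a Lipschitz constant of ∇f_i on the segment conv{x, x + tp}. Then t ≥ (1/(L‖p‖²)) · ( −(1 − c₂) ∇f(x)ᵀp + (∇f(x) − ∇f_i(x))ᵀp ). -/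
open Filter Topology Matrix RealInnerProductSpace

noncomputable section

/-- Lemma `lem:lower_bound_Wolfe`: a lower bound on step lengths
satisfying the curvature (second Wolfe) condition. -/
theorem lower_bound_Wolfe {n m : ℕ} (f : Euc n → ℝ) (φ : Fin m → Euc n → ℝ)
    (hA1 : A1 f φ) (x p : Euc n) (t c2 L : ℝ) (i : Fin m)
    (hx : DifferentiableAt ℝ f x)
    (hc2 : c2 ∈ Set.Ioo (0 : ℝ) 1)
    (hdesc : ⟪gradient f x, p⟫ < 0)
    (ht : 0 < t)
    (hxt : DifferentiableAt ℝ f (x + t • p))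
    (hW2 : c2 * ⟪gradient f x, p⟫ ≤ ⟪gradient f (x + t • p), p⟫)
    (hi : i ∈ Ig f φ (x + t • p))
    (hL : 0 < L)
    (hLip : LipschitzOnWith (Real.toNNReal L) (gradient (φ i)) (segment ℝ x (x + t • p))) :
    t ≥ (1 / (L * ‖p‖ ^ 2)) *
      (-(1 - c2) * ⟪gradient f x, p⟫ + ⟪gradient f x - gradient (φ i) x, p⟫) := by
  have hp : p ≠ 0 := by
    rintro rfl
    simp at hdesc
  have hpos : 0 < L * ‖p‖ ^ 2 := by positivity
  have hdist : ‖gradient (φ i) (x + t • p) - gradient (φ i) x‖ ≤ L * (t * ‖p‖) := by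
    simpa [dist_eq_norm, norm_smul, abs_of_pos ht, Real.coe_toNNReal L hL.le] using
      hLip.dist_le_mul _ (right_mem_segment ℝ x (x + t • p)) _ (left_mem_segment ℝ x (x + t • p))
  have hinner : ⟪gradient (φ i) (x + t • p) - gradient (φ i) x, p⟫ ≤ L * (t * ‖p‖) * ‖p‖ :=
    (real_inner_le_norm _ _).trans (mul_le_mul_of_nonneg_right hdist (norm_nonneg p))
  rw [hi.2] at hW2
  rw [inner_sub_left] at hinner
  rw [ge_iff_le, one_div, inv_mul_le_iff₀ hpos, inner_sub_left]
  linarith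
end
end

section
/- Suppose f satisfies (A1) and Behavior (B1) holds with limit point x̄. Then the sequence of matrices (H_k) has an accumulation point, and every accumulation point H̄ of (H_k) satisfies ker(H̄) = N(x̄). -/
open Filter Topology Matrix RealInnerProductSpace

noncomputable section

/-- The entries of a positive semidefinite matrix whose quadratic form is bounded by
`σ * ‖v‖ ^ 2` are bounded by `σ` in absolute value. -/
theorem Matrix.PosSemidef.abs_apply_le {n : ℕ} {M : Matrix (Fin n) (Fin n) ℝ} {σ : ℝ}
    (hM : M.PosSemidef) (hσ : ∀ v : Euc n, ⟪v, Matrix.toEuclideanLin M v⟫ ≤ σ * ‖v‖ ^ 2)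
    (i j : Fin n) : |M i j| ≤ σ := by
  have hdiag (k : Fin n) : M k k ≤ σ := by
    simpa [Matrix.toLpLin_apply, EuclideanSpace.inner_single_left] using
      hσ (EuclideanSpace.single k 1)
  have hsymm : M j i = M i j := by simpa using hM.isHermitian.apply i j
  have hplus := hM.dotProduct_mulVec_nonneg (Pi.single i 1 + Pi.single j 1)
  have hminus := hM.dotProduct_mulVec_nonneg (Pi.single i 1 - Pi.single j 1)
  simp [Matrix.mulVec_add, Matrix.mulVec_sub, add_dotProduct, sub_dotProduct, hsymm]
    at hplus hminus
  rw [abs_le]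
  constructor <;> linarith [hdiag i, hdiag j]

/-- A sequence of matrices with uniformly bounded entries has an accumulation point. -/
theorem Matrix.exists_mapClusterPt_of_abs_apply_le {n : ℕ} {H : ℕ → Matrix (Fin n) (Fin n) ℝ}
    {σ : ℝ} (h : ∀ k i j, |H k i j| ≤ σ) :
    ∃ M : Matrix (Fin n) (Fin n) ℝ, MapClusterPt M atTop H := by
  have hK : IsCompact (Set.univ.pi fun _ : Fin n => Set.univ.pi fun _ : Fin n =>
      Set.Icc (-σ) σ) :=
    isCompact_univ_pi fun _ => isCompact_univ_pi fun _ => isCompact_Icc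
  obtain ⟨M, -, hM⟩ := hK.exists_mapClusterPt (f := atTop) (u := H)
    (tendsto_principal.mpr <| Eventually.of_forall fun k i _ j _ => abs_le.mp (h k i j))
  exact ⟨M, hM⟩

/-- If `H k v → 0`, then every accumulation point of `H` annihilates `v`. -/
theorem MapClusterPt.toEuclideanLin_apply_eq_zero {n : ℕ}
    {H : ℕ → Matrix (Fin n) (Fin n) ℝ} {M : Matrix (Fin n) (Fin n) ℝ}
    (hM : MapClusterPt M atTop H) {v : Euc n}
    (hv : Tendsto (fun k => Matrix.toEuclideanLin (H k) v) atTop (𝓝 0)) :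
    Matrix.toEuclideanLin M v = 0 := by
  have hcont : Continuous fun A : Matrix (Fin n) (Fin n) ℝ => Matrix.toEuclideanLin A v :=
    ((Matrix.toEuclideanLin (𝕜 := ℝ) (m := Fin n) (n := Fin n)).toLinearMap.flip
      v).continuous_of_finiteDimensional
  have hcl : MapClusterPt (Matrix.toEuclideanLin M v) atTop
      (fun k => Matrix.toEuclideanLin (H k) v) :=
    MapClusterPt.continuousAt_comp (f := fun A => Matrix.toEuclideanLin A v)
      hcont.continuousAt hM
  have : ClusterPt (Matrix.toEuclideanLin M v) (𝓝 0) := hcl.clusterPt.mono hv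
  exact eq_of_nhds_neBot this

/-- If each `H k` is bounded below by `σ > 0` on some subspace of dimension at least `n - d`,
then the kernel of every accumulation point of `H` has dimension at most `d`. -/
theorem MapClusterPt.finrank_ker_toEuclideanLin_le {n d : ℕ}
    {H : ℕ → Matrix (Fin n) (Fin n) ℝ} {M : Matrix (Fin n) (Fin n) ℝ} {σ : ℝ}
    (hM : MapClusterPt M atTop H) (hσ : 0 < σ)
    (hW : ∀ k, ∃ W : Submodule ℝ (Euc n), n - d ≤ Module.finrank ℝ W ∧
      ∀ v ∈ W, σ * ‖v‖ ^ 2 ≤ ⟪v, Matrix.toEuclideanLin (H k) v⟫) :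
    Module.finrank ℝ (LinearMap.ker (Matrix.toEuclideanLin M)) ≤ d := by
  by_contra! hlt
  have hcont : Continuous fun A : Matrix (Fin n) (Fin n) ℝ =>
      Matrix.toEuclideanCLM (n := Fin n) (𝕜 := ℝ) (A - M) :=
    ((Matrix.toEuclideanCLM (n := Fin n) (𝕜 := ℝ)).toAlgEquiv.toLinearMap
      ).continuous_of_finiteDimensional.comp (continuous_id.sub continuous_const)
  have hev : ∀ᶠ A in 𝓝 M, ‖Matrix.toEuclideanCLM (n := Fin n) (𝕜 := ℝ) (A - M)‖ < σ :=
    hcont.norm.continuousAt.eventually_lt continuousAt_const (by simpa using hσ)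
  obtain ⟨k, hk⟩ := (hM.frequently hev).exists
  obtain ⟨W, hdim, hcoer⟩ := hW k
  have hndisj : ¬ Disjoint (LinearMap.ker (Matrix.toEuclideanLin M)) W := by
    intro hdisj
    have hsum := Submodule.finrank_add_finrank_le_of_disjoint hdisj
    rw [finrank_euclideanSpace_fin] at hsum
    have hnat : ∀ a b : ℕ, d < a → n - d ≤ b → ¬ a + b ≤ n := by omega
    exact hnat _ _ hlt hdim hsum
  rw [Submodule.disjoint_def] at hndisj
  push Not at hndisj
  obtain ⟨v, hker, hvW, hv⟩ := hndisj
  have hsub : Matrix.toEuclideanCLM (n := Fin n) (𝕜 := ℝ) (H k - M) v =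
      Matrix.toEuclideanLin (H k) v := by
    have h0 : Matrix.toEuclideanCLM (n := Fin n) (𝕜 := ℝ) M v = 0 := hker
    rw [map_sub, _root_.sub_apply, h0, sub_zero]
    rfl
  have hpos : 0 < ‖v‖ := norm_pos_iff.mpr hv
  refine lt_irrefl (σ * ‖v‖ ^ 2) ?_
  calc σ * ‖v‖ ^ 2 ≤ ⟪v, Matrix.toEuclideanLin (H k) v⟫ := hcoer v hvW
    _ ≤ ‖v‖ * ‖Matrix.toEuclideanLin (H k) v‖ := real_inner_le_norm _ _
    _ ≤ ‖v‖ * (‖Matrix.toEuclideanCLM (n := Fin n) (𝕜 := ℝ) (H k - M)‖ * ‖v‖) := by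
        rw [← hsub]
        gcongr
        exact ContinuousLinearMap.le_opNorm _ _
    _ = ‖Matrix.toEuclideanCLM (n := Fin n) (𝕜 := ℝ) (H k - M)‖ * ‖v‖ ^ 2 := by ring
    _ < σ * ‖v‖ ^ 2 := by gcongr

/-- Lemma `lem:ker_H_subsequence`: under (A1) and Behavior (B1), the
sequence `(H_k)` has an accumulation point, and every accumulation point `H̄`
satisfies `ker(H̄) = N(x̄)`. -/
theorem ker_H_subsequence {n m : ℕ} [NeZero m] (f : Euc n → ℝ) (φ : Fin m → Euc n → ℝ)
    (c1 c2 : ℝ) (x : ℕ → Euc n) (H : ℕ → Matrix (Fin n) (Fin n) ℝ) (t : ℕ → ℝ)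
    (xbar : Euc n) (hA1 : A1 f φ) (hB1 : B1 f φ c1 c2 x H t xbar) :
    (∃ Hbar : Matrix (Fin n) (Fin n) ℝ, MapClusterPt Hbar atTop H) ∧
    ∀ Hbar : Matrix (Fin n) (Fin n) ℝ, MapClusterPt Hbar atTop H →
      LinearMap.ker (Matrix.toEuclideanLin Hbar) = NSpace φ xbar := by
  obtain ⟨-, hpd, -, -, -, -, -, ⟨σL, σU, hσL, -, hbound⟩, hnull⟩ := hB1
  refine ⟨Matrix.exists_mapClusterPt_of_abs_apply_le fun k =>
    (hpd k).2.posSemidef.abs_apply_le (hbound k).1, fun Hbar hHbar => ?_⟩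
  have hle : NSpace φ xbar ≤ LinearMap.ker (Matrix.toEuclideanLin Hbar) := by
    refine Submodule.span_le.mpr ?_
    rintro _ ⟨i, rfl⟩
    exact hHbar.toEuclideanLin_apply_eq_zero (hnull i)
  refine (Submodule.eq_of_le_of_finrank_le hle ?_).symm
  refine hHbar.finrank_ker_toEuclideanLin_le hσL fun k => ?_
  obtain ⟨W, hdim, hcoer⟩ := (hbound k).2
  exact ⟨W, hdim.ge, hcoer⟩
end
end

section
/- Suppose f satisfies (A1) and Behavior (B1) holds with limit point x̄ and search directions p^k = −H_k ∇f(x^k). Then lim_{k→∞} ∇f(x^k)ᵀ p^k = 0. -/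
open Filter Topology Matrix RealInnerProductSpace

noncomputable section

/-- The gradient of a selection of finitely many differentiable functions is, wherever it exists,
the gradient of one of them. -/
lemma exists_gradient_eq_of_selection {E ι : Type*} [NormedAddCommGroup E]
    [InnerProductSpace ℝ E] [CompleteSpace E] [Finite ι] {f : E → ℝ} {φ : ι → E → ℝ}
    (hsel : ∀ y, ∃ i, f y = φ i y) {x : E} (hφ : ∀ i, DifferentiableAt ℝ (φ i) x)
    (hf : DifferentiableAt ℝ f x) : ∃ i, gradient f x = gradient (φ i) x := by
  by_contra! hne
  have hfderiv : ∀ i, ∃ v, (fderiv ℝ f x - fderiv ℝ (φ i) x).toLinearMap v ≠ 0 := by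
    intro i
    by_contra! hzero
    refine hne i ?_
    have : fderiv ℝ f x = fderiv ℝ (φ i) x := by
      ext v
      exact sub_eq_zero.mp (hzero v)
    simp only [gradient, this]
  obtain ⟨v, hv⟩ := Module.Dual.exists_forall_ne_zero_of_forall_exists _ hfderiv
  have hderiv : ∀ i, HasDerivAt (fun s : ℝ => f (x + s • v) - φ i (x + s • v))
      ((fderiv ℝ f x - fderiv ℝ (φ i) x) v) 0 := by
    intro i
    have hline : HasDerivAt (fun s : ℝ => x + s • v) v 0 := by
      simpa using ((hasDerivAt_id (0 : ℝ)).smul_const v).const_add x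
    have hx : x = x + (0 : ℝ) • v := by simp
    exact (hf.hasFDerivAt.sub (hφ i).hasFDerivAt).comp_hasDerivAt_of_eq 0 hline hx
  have hev : ∀ᶠ s : ℝ in 𝓝[≠] 0, ∀ i, f (x + s • v) - φ i (x + s • v) ≠ 0 :=
    eventually_all.mpr fun i => (hderiv i).eventually_ne (hv i)
  obtain ⟨s, hs⟩ := hev.exists
  obtain ⟨i, hi⟩ := hsel (x + s • v)
  exact hs i (sub_eq_zero.mpr hi)

/-- A positive operator whose quadratic form is bounded by `σ` has norm at most `σ`. -/
lemma LinearMap.IsPositive.norm_apply_le {E : Type*} [NormedAddCommGroup E]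
    [InnerProductSpace ℝ E] {L : E →ₗ[ℝ] E} (hL : L.IsPositive) {σ : ℝ} (hσ : 0 < σ)
    (hub : ∀ v, ⟪v, L v⟫ ≤ σ * ‖v‖ ^ 2) (v : E) : ‖L v‖ ≤ σ * ‖v‖ := by
  have hpos : 0 ≤ ⟪L (σ • v - L v), σ • v - L v⟫ := hL.inner_nonneg_left _
  have hsymm : ⟪L (L v), v⟫ = ⟪L v, L v⟫ := hL.isSymmetric (L v) v
  have hexp : ⟪L (σ • v - L v), σ • v - L v⟫ =
      σ ^ 2 * ⟪v, L v⟫ - 2 * σ * ‖L v‖ ^ 2 + ⟪L v, L (L v)⟫ := by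
    simp only [map_sub, map_smul, inner_sub_left, inner_sub_right, real_inner_smul_left,
      real_inner_smul_right, hsymm, real_inner_self_eq_norm_sq, real_inner_comm (L v) v,
      real_inner_comm (L (L v)) (L v)]
    ring
  have hv := mul_le_mul_of_nonneg_left (hub v) (sq_nonneg σ)
  have hLv := hub (L v)
  have hsq : σ * ‖L v‖ ^ 2 ≤ σ * (σ * ‖v‖) ^ 2 := by
    rw [hexp] at hpos
    linarith
  exact le_of_sq_le_sq (le_of_mul_le_mul_left hsq hσ) (by positivity)

/-- under (A1) and Behavior (B1), `∇f(x^k)ᵀ p^k → 0` where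
`p^k = −H_k ∇f(x^k)`. -/
theorem directional_derivative_tendsto_zero {n m : ℕ} [NeZero m]
    (f : Euc n → ℝ) (φ : Fin m → Euc n → ℝ)
    (c1 c2 : ℝ) (x : ℕ → Euc n) (H : ℕ → Matrix (Fin n) (Fin n) ℝ) (t : ℕ → ℝ)
    (xbar : Euc n) (hA1 : A1 f φ) (hB1 : B1 f φ c1 c2 x H t xbar) :
    Tendsto (fun k =>
        ⟪gradient f (x k), -(Matrix.toEuclideanLin (H k) (gradient f (x k)))⟫)
      atTop (𝓝 0) := by
  obtain ⟨-, hsel, hφ⟩ := hA1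
  obtain ⟨⟨-, -, hc2⟩, hH, hstep, hW, hdiff, hlim, -, ⟨σL, σ, hσL, hσLU, hσ⟩, hnull⟩ := hB1
  have hσ0 : 0 < σ := hσL.trans_le hσLU
  have hpos : ∀ k, (Matrix.toEuclideanLin (H k)).IsPositive := fun k =>
    Matrix.isPositive_toEuclideanLin_iff.mpr (hH k).2.posSemidef
  have hbound : ∀ k v, ‖Matrix.toEuclideanLin (H k) v‖ ≤ σ * ‖v‖ := fun k =>
    (hpos k).norm_apply_le hσ0 (hσ k).1
  have hgrad : ∀ k, ∃ i, gradient f (x k) = gradient (φ i) (x k) := fun k =>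
    exists_gradient_eq_of_selection hsel
      (fun i => (hφ i).1.differentiable (by norm_num) (x k)) (hdiff k).1
  set S : ℕ → ℝ := fun k => ∑ i, ‖gradient (φ i) (x k) - gradient (φ i) xbar‖
  set T : ℕ → ℝ := fun k =>
    ∑ i, ‖Matrix.toEuclideanLin (H k) (gradient (φ i) xbar - gradient (φ 0) xbar)‖
  set C : ℝ := ∑ i, ‖gradient (φ i) xbar‖
  have hS0 : Tendsto S atTop (𝓝 0) := by
    rw [← Finset.sum_const_zero (s := (Finset.univ : Finset (Fin m)))]
    refine tendsto_finsetSum _ fun i _ => ?_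
    exact tendsto_iff_norm_sub_tendsto_zero.mp (((hφ i).2.continuous.tendsto xbar).comp hlim)
  have hT0 : Tendsto T atTop (𝓝 0) := by
    rw [← Finset.sum_const_zero (s := (Finset.univ : Finset (Fin m)))]
    refine tendsto_finsetSum _ fun i _ => ?_
    simpa using (hnull i).norm
  have hSle : ∀ i k, ‖gradient (φ i) (x k) - gradient (φ i) xbar‖ ≤ S k := fun i k =>
    Finset.single_le_sum (f := fun i => ‖gradient (φ i) (x k) - gradient (φ i) xbar‖)
      (fun _ _ => norm_nonneg _) (Finset.mem_univ i)
  have hTle : ∀ i k,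
      ‖Matrix.toEuclideanLin (H k) (gradient (φ i) xbar - gradient (φ 0) xbar)‖ ≤ T k :=
    fun i k => Finset.single_le_sum
      (f := fun i => ‖Matrix.toEuclideanLin (H k) (gradient (φ i) xbar - gradient (φ 0) xbar)‖)
      (fun _ _ => norm_nonneg _) (Finset.mem_univ i)
  have hCle : ∀ i, ‖gradient (φ i) xbar‖ ≤ C := fun i =>
    Finset.single_le_sum (f := fun i => ‖gradient (φ i) xbar‖)
      (fun _ _ => norm_nonneg _) (Finset.mem_univ i)
  have hgle : ∀ k, ‖gradient f (x k)‖ ≤ S k + C := by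
    intro k
    obtain ⟨i, hi⟩ := hgrad k
    have := norm_le_norm_sub_add (gradient (φ i) (x k)) (gradient (φ i) xbar)
    rw [hi]
    linarith [hSle i k, hCle i]
  have himage : ∀ k l,
      ‖Matrix.toEuclideanLin (H k) (gradient f (x l) - gradient (φ 0) xbar)‖ ≤ σ * S l + T k := by
    intro k l
    obtain ⟨i, hi⟩ := hgrad l
    rw [hi, ← sub_add_sub_cancel _ (gradient (φ i) xbar) _, map_add]
    refine (norm_add_le _ _).trans (add_le_add ((hbound k _).trans ?_) (hTle i k))
    exact mul_le_mul_of_nonneg_left (hSle i l) hσ0.le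
  have hmain : ∀ k,
      (1 - c2) * ⟪gradient f (x k), Matrix.toEuclideanLin (H k) (gradient f (x k))⟫ ≤
        ((σ * S (k + 1) + T k) + (σ * S k + T k)) * (S k + C) := by
    intro k
    have hcurv := (hW k).2.2.2
    rw [← hstep k, inner_neg_right, inner_neg_right] at hcurv
    have hsplit : Matrix.toEuclideanLin (H k) (gradient f (x (k + 1)) - gradient f (x k)) =
        Matrix.toEuclideanLin (H k) (gradient f (x (k + 1)) - gradient (φ 0) xbar) -
          Matrix.toEuclideanLin (H k) (gradient f (x k) - gradient (φ 0) xbar) := by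
      rw [← map_sub, sub_sub_sub_cancel_right]
    have hnorm : ‖Matrix.toEuclideanLin (H k) (gradient f (x (k + 1)) - gradient f (x k))‖ ≤
        (σ * S (k + 1) + T k) + (σ * S k + T k) := by
      rw [hsplit]
      exact (norm_sub_le _ _).trans (add_le_add (himage k (k + 1)) (himage k k))
    have hCS := abs_real_inner_le_norm
      (Matrix.toEuclideanLin (H k) (gradient f (x (k + 1)) - gradient f (x k))) (gradient f (x k))
    have hprod := mul_le_mul hnorm (hgle k) (norm_nonneg _) ((norm_nonneg _).trans hnorm)
    have hsymm := (hpos k).isSymmetric (gradient f (x (k + 1)) - gradient f (x k))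
      (gradient f (x k))
    rw [inner_sub_left] at hsymm
    have hneg := neg_abs_le
      ⟪Matrix.toEuclideanLin (H k) (gradient f (x (k + 1)) - gradient f (x k)), gradient f (x k)⟫
    linarith
  have hzero : Tendsto (fun k => ((σ * S (k + 1) + T k) + (σ * S k + T k)) * (S k + C) / (1 - c2))
      atTop (𝓝 0) := by
    have hS1 := (tendsto_add_atTop_iff_nat 1).mpr hS0
    simpa using (((((hS1.const_mul σ).add hT0).add ((hS0.const_mul σ).add hT0)).mul
      (hS0.add_const C)).div_const (1 - c2))
  have hquad : Tendsto
      (fun k => ⟪gradient f (x k), Matrix.toEuclideanLin (H k) (gradient f (x k))⟫)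
      atTop (𝓝 0) := by
    refine squeeze_zero (fun k => (hpos k).inner_nonneg_right _) (fun k => ?_) hzero
    rw [le_div_iff₀ (sub_pos.mpr hc2), mul_comm]
    exact hmain k
  simpa only [inner_neg_right, neg_zero] using hquad.neg
end
end

section
/- Suppose f satisfies (A1) and (A2.1) with critical point x*. Then there is an open neighborhood U ⊆ ℝ^n of x* such that for every x ∈ U with I_e(x) = I for which the vectors ∇f_i(x), i ∈ I, are linearly dependent, x is a Clarke critical point of f; indeed, there exist β_i > 0, i ∈ I, with Σ_{i=1}^m β_i ∇f_i(x) = 0. -/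
open Filter Topology Matrix RealInnerProductSpace

noncomputable section

/-- Assumption (A2.1): at `x*` there is a strictly positive vanishing convex-type
combination of the gradients `∇f_i(x*)`, and these gradients are affinely independent. -/
def A21 {n m : ℕ} (φ : Fin m → Euc n → ℝ) (xstar : Euc n) : Prop :=
  (∃ α : Fin m → ℝ, (∀ i, 0 < α i) ∧ ∑ i, α i • gradient (φ i) xstar = 0) ∧
  AffineIndependent ℝ (fun i : Fin m => gradient (φ i) xstar)

/-- Lifting an affinely independent family to height one makes it linearly independent. -/
theorem AffineIndependent.linearIndependent_prodMk_one {ι E : Type*} [Fintype ι]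
    [AddCommGroup E] [Module ℝ E] {v : ι → E} (hv : AffineIndependent ℝ v) :
    LinearIndependent ℝ (fun i => (v i, (1 : ℝ))) := by
  rw [Fintype.linearIndependent_iff]
  intro c hc i
  have h₁ : ∑ j, c j • v j = 0 := by simpa [Prod.fst_sum] using congrArg Prod.fst hc
  have h₂ : ∑ j, c j = 0 := by simpa [Prod.snd_sum] using congrArg Prod.snd hc
  exact affineIndependent_iff.1 hv Finset.univ c h₂ h₁ i (Finset.mem_univ i)

/-- If continuous vectors `g i` are affinely independent at `x₀` and have there a strictly
positive vanishing combination, then at nearby points every linear dependence among them can be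
realised by a strictly positive vanishing combination. -/
theorem AffineIndependent.eventually_exists_pos_sum_smul_eq_zero {ι X E : Type*} [Fintype ι]
    [TopologicalSpace X] [NormedAddCommGroup E] [NormedSpace ℝ E] [FiniteDimensional ℝ E]
    {g : ι → X → E} {x₀ : X} (hg : ∀ i, ContinuousAt (g i) x₀)
    (haff : AffineIndependent ℝ (fun i => g i x₀)) {α : ι → ℝ} (hα : ∀ i, 0 < α i)
    (hsum : ∑ i, α i • g i x₀ = 0) :
    ∀ᶠ x in 𝓝 x₀, ¬ LinearIndependent ℝ (fun i => g i x) →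
      ∃ β : ι → ℝ, (∀ i, 0 < β i) ∧ ∑ i, β i • g i x = 0 := by
  classical
  rcases isEmpty_or_nonempty ι with hι | hι
  · exact Eventually.of_forall fun x hx => (hx linearIndependent_empty_type).elim
  obtain ⟨L₀, hL₀⟩ := LinearMap.exists_leftInverse_of_injective
    (Fintype.linearCombination ℝ (fun i => (g i x₀, (1 : ℝ))))
    (LinearMap.ker_eq_bot.2 haff.linearIndependent_prodMk_one.fintypeLinearCombination_injective)
  let L : E × ℝ →L[ℝ] (ι → ℝ) := LinearMap.toContinuousLinearMap L₀
  let A : X → (ι → ℝ) →L[ℝ] (ι → ℝ) := fun x =>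
    ∑ i, (ContinuousLinearMap.proj i : (ι → ℝ) →L[ℝ] ℝ).smulRight (L (g i x, 1))
  have hA (x : X) (c : ι → ℝ) : A x c = L (∑ i, c i • g i x, ∑ i, c i) := by
    have : (∑ i, c i • g i x, ∑ i, c i) = ∑ i, c i • (g i x, (1 : ℝ)) := by
      ext <;> simp [Prod.fst_sum, Prod.snd_sum]
    rw [this, map_sum]
    simp only [map_smul, A, _root_.sum_apply, ContinuousLinearMap.smulRight_apply,
      ContinuousLinearMap.proj_apply]
  have hA₀ : A x₀ = 1 := by
    ext1 c
    have := LinearMap.congr_fun hL₀ c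
    rw [hA]
    refine Eq.trans ?_ this
    simp only [LinearMap.comp_apply, Fintype.linearCombination_apply]
    change L₀ _ = L₀ _
    congr 1
    ext <;> simp [Prod.fst_sum, Prod.snd_sum]
  have hAcont : ContinuousAt A x₀ := by
    refine tendsto_finsetSum _ fun i _ => ?_
    exact ((ContinuousLinearMap.smulRightL ℝ (ι → ℝ) (ι → ℝ)
      (ContinuousLinearMap.proj i)).continuous.comp L.continuous).continuousAt.comp
        ((hg i).prodMk continuousAt_const)
  let u : X → ι → ℝ := fun x => Ring.inverse (A x) (L (0, ∑ i, α i))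
  have hu₀ : u x₀ = α := by
    have h := hA x₀ α
    rw [hsum, hA₀] at h
    simp [u, hA₀, ← h]
  have hucont : ContinuousAt u x₀ := by
    have hinv : ContinuousAt Ring.inverse (A x₀) := by
      simpa [hA₀] using NormedRing.inverse_continuousAt (1 : ((ι → ℝ) →L[ℝ] (ι → ℝ))ˣ)
    exact (ContinuousAt.comp (f := A) hinv hAcont).clm_apply continuousAt_const
  have hpos : ∀ᶠ x in 𝓝 x₀, ∀ i, 0 < u x i := eventually_all.2 fun i =>
    ((continuousAt_pi.1 hucont) i).eventually (lt_mem_nhds (by simpa [hu₀] using hα i))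
  have hunit : ∀ᶠ x in 𝓝 x₀, IsUnit (A x) :=
    hAcont.eventually (Units.isOpen.mem_nhds (by simp [hA₀]))
  filter_upwards [hpos, hunit] with x hx hxu hdep
  rw [Fintype.not_linearIndependent_iff] at hdep
  obtain ⟨c, hc, i, hi⟩ := hdep
  have hinv (b : ι → ℝ) : Ring.inverse (A x) (A x b) = b := by
    rw [← mul_apply_eq_comp, Ring.inverse_mul_cancel _ hxu,
      one_apply_eq_self]
  have hs : ∑ j, c j ≠ 0 := by
    intro hs
    have h := hinv c
    rw [hA, hc, hs, Prod.mk_zero_zero, map_zero, map_zero] at h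
    exact hi (congrFun h i).symm
  let t : ℝ := (∑ j, α j) / ∑ j, c j
  have hrel : ∑ j, (t • c) j • g j x = 0 := by
    simp [mul_smul, ← Finset.smul_sum, hc]
  have htot : ∑ j, (t • c) j = ∑ j, α j := by
    simp only [Pi.smul_apply, smul_eq_mul, ← Finset.mul_sum, t]
    exact div_mul_cancel₀ _ hs
  have hcu : t • c = u x := by
    have h := hinv (t • c)
    rw [hA, hrel, htot] at h
    exact h.symm
  exact ⟨t • c, fun j => hcu ▸ hx j, hrel⟩

/-- A strictly positive vanishing combination of a nonempty family puts `0` in its convex hull. -/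
theorem zero_mem_convexHull_range_of_sum_smul_eq_zero {ι E : Type*} [Fintype ι] [Nonempty ι]
    [AddCommGroup E] [Module ℝ E] {v : ι → E} {β : ι → ℝ} (hβ : ∀ i, 0 < β i)
    (hsum : ∑ i, β i • v i = 0) : (0 : E) ∈ convexHull ℝ (Set.range v) := by
  have h := Finset.univ.centerMass_mem_convexHull (R := ℝ) (w := β) (z := v)
    (fun i _ => (hβ i).le) (Finset.sum_pos (fun i _ => hβ i) Finset.univ_nonempty)
    (fun i _ => Set.mem_range_self i)
  rwa [Finset.centerMass, hsum, smul_zero] at h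

/-- Lemma `lem:crit_limit`: under (A1) and (A2.1), near `x*`, any point
with full essentially active set and linearly dependent gradients is Clarke critical,
the vanishing linear combination being a strictly positive one. -/
theorem crit_limit {n m : ℕ} (f : Euc n → ℝ) (φ : Fin m → Euc n → ℝ) (xstar : Euc n)
    (hA1 : A1 f φ) (hA21 : A21 φ xstar) :
    ∃ U : Set (Euc n), IsOpen U ∧ xstar ∈ U ∧
      ∀ x ∈ U, Ie f φ x = Set.univ →
        ¬ LinearIndependent ℝ (fun i : Fin m => gradient (φ i) x) →
          (0 ∈ convexHull ℝ ((fun i : Fin m => gradient (φ i) x) '' Ie f φ x) ∧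
           ∃ β : Fin m → ℝ, (∀ i, 0 < β i) ∧ ∑ i, β i • gradient (φ i) x = 0) := by
  obtain ⟨-, hsel, hφ⟩ := hA1
  obtain ⟨⟨α, hα, hsum⟩, haff⟩ := hA21
  obtain ⟨U, hU, hUo, hxU⟩ := eventually_nhds_iff.1
    (haff.eventually_exists_pos_sum_smul_eq_zero
      (fun i => (hφ i).2.continuous.continuousAt) hα hsum)
  refine ⟨U, hUo, hxU, fun x hx hIe hdep => ?_⟩
  obtain ⟨β, hβ, hβsum⟩ := hU x hx hdep
  have : Nonempty (Fin m) := ⟨(hsel x).choose⟩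
  refine ⟨?_, β, hβ, hβsum⟩
  rw [hIe, Set.image_univ]
  exact zero_mem_convexHull_range_of_sum_smul_eq_zero hβ hβsum
end
end

section
/- Suppose f satisfies (A1), let x* ∈ ℝ^n be a point at which the vectors ∇f_i(x*), i ∈ I, are affinely independent, and assume that I_g(x) is nonempty for every x ∉ Ω. Then there is an open neighborhood U ⊆ ℝ^n of x* such that |I_g(x)| = 1 for all x ∈ U \ Ω. -/
open Filter Topology Matrix RealInnerProductSpace

noncomputable section

/-- Lemma `lem:aff_lin_indep_and_A_g_singleton`(a): if the gradients
`∇f_i(x*)` are affinely independent and `I_g(x)` is nonempty at points of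
differentiability, then `|I_g(x)| = 1` near `x*`. -/
theorem Ig_singleton_near {n m : ℕ} (f : Euc n → ℝ) (φ : Fin m → Euc n → ℝ)
    (xstar : Euc n) (hA1 : A1 f φ)
    (haff : AffineIndependent ℝ (fun i : Fin m => gradient (φ i) xstar))
    (hne : ∀ x : Euc n, DifferentiableAt ℝ f x → (Ig f φ x).Nonempty) :
    ∃ U : Set (Euc n), IsOpen U ∧ xstar ∈ U ∧
      ∀ x ∈ U, DifferentiableAt ℝ f x → ∃! i : Fin m, i ∈ Ig f φ x := by
  have hev : ∀ᶠ x in 𝓝 xstar, ∀ i j : Fin m, i ≠ j →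
      gradient (φ i) x ≠ gradient (φ j) x := by
    simp only [eventually_all]
    intro i j hij
    exact (isOpen_ne_fun (hA1.2.2 i).2.continuous (hA1.2.2 j).2.continuous).mem_nhds
      (haff.injective.ne hij)
  obtain ⟨U, hU, hUopen, hxU⟩ := eventually_nhds_iff.1 hev
  refine ⟨U, hUopen, hxU, fun x hx hfx => ?_⟩
  obtain ⟨i, hi⟩ := hne x hfx
  refine ⟨i, hi, fun j hj => ?_⟩
  by_contra hji
  exact hU x hx j i hji (hj.2.symm.trans hi.2)
end
end

section
/- Suppose f satisfies (A2) with unique global minimum x*, and let (x^{l,0})_l ⊆ ℝ^n be a sequence of initial points with x^{l,0} → x* for which Behavior (B2) holds. Then there exists N > 0 such that for all l > N, the union of the sets I_g(x^{l,k}) over k = 0,…,m−1 equals I = {1,…,m}. -/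
open Filter Topology Matrix RealInnerProductSpace

noncomputable section

/-- Assumption (A2.2): `x*` is the unique global minimum of `f` and some sublevel set
`{x | f x ≤ f z}` with `z ≠ x*` is bounded. -/
def A22 {n : ℕ} (f : Euc n → ℝ) (xstar : Euc n) : Prop :=
  (∀ x, x ≠ xstar → f xstar < f x) ∧
  ∃ z : Euc n, z ≠ xstar ∧ Bornology.IsBounded {x : Euc n | f x ≤ f z}

/-- Behavior (B2): for each initial point `x^{l,0}` the quasi-Newton method runs for the
first `m−1` iterations with Wolfe step lengths, secant equations, a uniform eigenvalue
bound (B2.1), and the memory property (B2.2). -/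
def B2 {n : ℕ} (m : ℕ) (f : Euc n → ℝ)
    (x : ℕ → ℕ → Euc n) (H : ℕ → ℕ → Matrix (Fin n) (Fin n) ℝ) (t : ℕ → ℕ → ℝ) : Prop :=
  ∃ c1 c2 σL σU : ℝ, 0 < c1 ∧ c1 < c2 ∧ c2 < 1 ∧ 0 < σL ∧ σL ≤ σU ∧
    (∀ l,
      -- the algorithm does not stop in the first m−1 iterations
      (∀ k < m, DifferentiableAt ℝ f (x l k) ∧ gradient f (x l k) ≠ 0) ∧
      (∀ k, (H l k).IsSymm ∧ (H l k).PosDef) ∧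
      (∀ k, k < m - 1 →
        x l (k+1) = x l k + t l k • (-(Matrix.toEuclideanLin (H l k) (gradient f (x l k)))) ∧
        0 < t l k ∧
        WolfeStep f c1 c2 (x l k) (-(Matrix.toEuclideanLin (H l k) (gradient f (x l k)))) (t l k) ∧
        -- secant equation H_{l,k+1} y^{l,k} = s^{l,k}
        Matrix.toEuclideanLin (H l (k+1)) (gradient f (x l (k+1)) - gradient f (x l k)) =
          x l (k+1) - x l k) ∧
      -- (B2.1)
      (∀ k, k < m - 1 →
        (∀ v : Euc n, ⟪v, Matrix.toEuclideanLin (H l k) v⟫ ≤ σU * ‖v‖ ^ 2) ∧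
        (∃ W : Submodule ℝ (Euc n), Module.finrank ℝ W = n - k ∧
          ∀ v ∈ W, σL * ‖v‖ ^ 2 ≤ ⟪v, Matrix.toEuclideanLin (H l k) v⟫))) ∧
    -- (B2.2)
    (∀ k' k : ℕ, 1 ≤ k' → k' < m - 1 → k < k' →
      Tendsto
        (fun l => Matrix.toEuclideanLin (H l k') (gradient f (x l (k+1)) - gradient f (x l k)))
        atTop (𝓝 0))

section QuasiNewtonLimit

variable {E : Type*} [NormedAddCommGroup E] [InnerProductSpace ℝ E]

/-- The Rayleigh quotient bound of a positive operator controls its operator norm. -/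
lemma norm_le_of_inner_le {T : E →L[ℝ] E} (hpos : (T : E →ₗ[ℝ] E).IsPositive) {σ : ℝ}
    (hσ : 0 ≤ σ) (hle : ∀ v, ⟪v, T v⟫ ≤ σ * ‖v‖ ^ 2) : ‖T‖ ≤ 2 * σ := by
  refine ContinuousLinearMap.opNorm_le_of_unit_norm (by positivity) fun v hv => ?_
  rcases eq_or_ne (T v) 0 with h0 | h0
  · rw [h0, norm_zero]
    positivity
  set u : E := ‖T v‖⁻¹ • T v with hu
  have hn : ‖T v‖ ≠ 0 := norm_ne_zero_iff.mpr h0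
  have hu1 : ‖u‖ = 1 := by
    rw [hu, norm_smul, norm_inv, norm_norm, inv_mul_cancel₀ hn]
  have huv : ⟪u, T v⟫ = ‖T v‖ := by
    rw [hu, real_inner_smul_left, real_inner_self_eq_norm_sq]
    field_simp
  have hvu : ⟪v, T u⟫ = ‖T v‖ := by
    have := hpos.1 v u
    simp only [ContinuousLinearMap.coe_coe] at this
    rw [← this, real_inner_comm, huv]
  have hnonneg : ∀ w, 0 ≤ ⟪w, T w⟫ := fun w => by simpa using hpos.inner_nonneg_right w
  have hsum := hle (u + v)
  have hnorm : ‖u + v‖ ≤ 2 := (norm_add_le u v).trans (by rw [hu1, hv]; norm_num)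
  have hsq : ‖u + v‖ ^ 2 ≤ 4 := by nlinarith [norm_nonneg (u + v)]
  rw [map_add, inner_add_left, inner_add_right, inner_add_right, huv, hvu] at hsum
  nlinarith [hnonneg u, hnonneg v, mul_le_mul_of_nonneg_left hsq hσ]

/-- Two subspaces whose dimensions add up to more than the dimension of the ambient space share a
unit vector. -/
lemma exists_unit_mem_of_finrank_lt [FiniteDimensional ℝ E] (V W : Submodule ℝ E)
    (h : Module.finrank ℝ E < Module.finrank ℝ V + Module.finrank ℝ W) :
    ∃ w ∈ V, w ∈ W ∧ ‖w‖ = 1 := by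
  have hd : ¬ Disjoint V W := fun hd =>
    (Submodule.finrank_add_finrank_le_of_disjoint hd).not_gt h
  rw [Submodule.disjoint_def] at hd
  push Not at hd
  obtain ⟨w, hV, hW, hw⟩ := hd
  exact ⟨‖w‖⁻¹ • w, V.smul_mem _ hV, W.smul_mem _ hW, by
    rw [norm_smul, norm_inv, norm_norm, inv_mul_cancel₀ (norm_ne_zero_iff.mpr hw)]⟩

/-- If the inverse Hessian approximations asymptotically annihilate the differences of the
gradients seen so far, then after a step satisfying the Wolfe curvature condition the gradient
cannot approach any of the limits of the previous gradients. -/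
lemma ne_of_curvature_condition [FiniteDimensional ℝ E] {ι : Type*} (U : Ultrafilter ι) {k : ℕ}
    {T : ι → E →L[ℝ] E} {σL σU c : ℝ} (hσL : 0 < σL) (hσU : 0 ≤ σU) (hc : c < 1)
    (hT : ∀ l, (T l : E →ₗ[ℝ] E).IsPositive)
    (hupper : ∀ l v, ⟪v, T l v⟫ ≤ σU * ‖v‖ ^ 2)
    (hlower : ∀ l, ∃ W : Submodule ℝ E, Module.finrank ℝ W = Module.finrank ℝ E - k ∧
      ∀ v ∈ W, σL * ‖v‖ ^ 2 ≤ ⟪v, T l v⟫)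
    {g : ℕ → ι → E} {G : ℕ → E} (hg : ∀ j ≤ k + 1, Tendsto (g j) U (𝓝 (G j)))
    (hG : LinearIndependent ℝ fun j : Fin (k + 1) => G j)
    (hmem : ∀ j < k, Tendsto (fun l => T l (g (j + 1) l - g j l)) U (𝓝 0))
    (hcurv : ∀ l, c * ⟪g k l, -T l (g k l)⟫ ≤ ⟪g (k + 1) l, -T l (g k l)⟫)
    {j : ℕ} (hj : j ≤ k) : G (k + 1) ≠ G j := by
  intro heq
  obtain ⟨S, -, hS⟩ := (isCompact_closedBall (0 : E →L[ℝ] E) (2 * σU)).ultrafilter_le_nhds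
    (U.map T) (by
      rw [Ultrafilter.coe_map, le_principal_iff, mem_map]
      exact Filter.univ_mem' fun l => by
        simpa using norm_le_of_inner_le (hT l) hσU (hupper l))
  replace hS : Tendsto T U (𝓝 S) := hS
  have happly : ∀ {v : ι → E} {a : E}, Tendsto v U (𝓝 a) →
      Tendsto (fun l => T l (v l)) U (𝓝 (S a)) := fun {v a} hv =>
    (isBoundedBilinearMap_apply.continuous.tendsto (S, a)).comp (hS.prodMk_nhds hv)
  have hsymm : ∀ u v, ⟪S u, v⟫ = ⟪u, S v⟫ := fun u v =>
    tendsto_nhds_unique ((happly tendsto_const_nhds).inner tendsto_const_nhds)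
      ((tendsto_const_nhds.inner (happly tendsto_const_nhds)).congr
        fun l => ((hT l).1 u v).symm)
  have hstep : ∀ i < k, S (G (i + 1)) = S (G i) := fun i hi => by
    have h := tendsto_nhds_unique (hmem i hi)
      (happly ((hg (i + 1) (by omega)).sub (hg i (by omega))))
    rw [map_sub] at h
    exact (sub_eq_zero.mp h.symm)
  have hconst : ∀ i ≤ k, S (G i) = S (G 0) := fun i => by
    induction i with
    | zero => exact fun _ => rfl
    | succ i ih => exact fun hi => (hstep i (by omega)).trans (ih (by omega))
  set V : Submodule ℝ E := Submodule.span ℝ (Set.range fun j : Fin (k + 1) => G j) with hV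
  have hVrank : Module.finrank ℝ V = k + 1 := by
    rw [hV, finrank_span_eq_card hG, Fintype.card_fin]
  have hk : k + 1 ≤ Module.finrank ℝ E := hVrank ▸ V.finrank_le
  have hw : ∀ l, ∃ w ∈ V, ‖w‖ = 1 ∧ σL ≤ ⟪w, T l w⟫ := fun l => by
    obtain ⟨W, hWrank, hW⟩ := hlower l
    obtain ⟨w, hwV, hwW, hw1⟩ := exists_unit_mem_of_finrank_lt V W (by omega)
    exact ⟨w, hwV, hw1, by simpa [hw1] using hW w hwW⟩
  choose w hwV hw1 hwT using hw
  obtain ⟨w', -, hw'⟩ := (isCompact_closedBall (0 : E) 1).ultrafilter_le_nhds (U.map w) (by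
    rw [Ultrafilter.coe_map, le_principal_iff, mem_map]
    exact Filter.univ_mem' fun l => by simp [hw1 l])
  replace hw' : Tendsto w U (𝓝 w') := hw'
  have hw'V : w' ∈ V := V.closed_of_finiteDimensional.mem_of_tendsto hw' (.of_forall hwV)
  have hw'S : σL ≤ ⟪w', S w'⟫ :=
    ge_of_tendsto (hw'.inner (happly hw')) (.of_forall hwT)
  obtain ⟨a, rfl⟩ := (Submodule.mem_span_range_iff_exists_fun ℝ).mp hw'V
  have hSw : S (∑ i, a i • G i) = (∑ i, a i) • S (G 0) := by
    rw [map_sum, Finset.sum_smul]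
    refine Finset.sum_congr rfl fun i _ => ?_
    rw [map_smul, hconst i (by omega)]
  have hGS : ∀ i ≤ k, ⟪G i, S (G 0)⟫ = ⟪G 0, S (G 0)⟫ := fun i hi => by
    rw [← hsymm, hconst i hi, hsymm]
  have hquad : ⟪∑ i, a i • G i, S (∑ i, a i • G i)⟫ = (∑ i, a i) ^ 2 * ⟪G 0, S (G 0)⟫ := by
    have hinner : ∀ i : Fin (k + 1), ⟪a i • G i, S (G 0)⟫ = a i * ⟪G 0, S (G 0)⟫ := fun i => by
      rw [real_inner_smul_left, hGS i (by omega)]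
    rw [hSw, real_inner_smul_right, sum_inner, pow_two, mul_assoc,
      Finset.sum_congr rfl fun i _ => hinner i, ← Finset.sum_mul]
  have hpos : 0 < ⟪G 0, S (G 0)⟫ := by
    rw [hquad] at hw'S
    exact pos_of_mul_pos_right (hσL.trans_le hw'S) (sq_nonneg _)
  have hlim : c * ⟪G k, -S (G k)⟫ ≤ ⟪G (k + 1), -S (G k)⟫ :=
    le_of_tendsto_of_tendsto'
      (tendsto_const_nhds.mul
        ((hg k (by omega)).inner (happly (hg k (by omega))).neg))
      ((hg (k + 1) le_rfl).inner (happly (hg k (by omega))).neg) hcurv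
  rw [heq, inner_neg_right, inner_neg_right, hconst k le_rfl, hGS k le_rfl, hGS j hj] at hlim
  nlinarith

/-- If a combination with positive coefficients of affinely independent vectors vanishes, then any
proper subfamily is linearly independent. -/
lemma linearIndependent_comp_of_affineIndependent {V ι κ : Type*} [AddCommGroup V] [Module ℝ V]
    [Fintype ι] [Fintype κ]
    {G : ι → V} (hG : AffineIndependent ℝ G) {α : ι → ℝ} (hα : ∀ i, 0 < α i)
    (hsum : ∑ i, α i • G i = 0) {e : κ → ι} (he : Function.Injective e) {i₀ : ι}
    (hi₀ : i₀ ∉ Set.range e) : LinearIndependent ℝ fun j => G (e j) := by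
  classical
  rw [Fintype.linearIndependent_iff]
  intro b hb j
  set B : ι → ℝ := Function.extend e b (0 : ι → ℝ) with hB
  have hBe : ∀ j, B (e j) = b j := fun j => he.extend_apply b (0 : ι → ℝ) j
  have hB0 : ∀ i, i ∉ Set.range e → B i = 0 := fun i hi => Function.extend_apply' b (0 : ι → ℝ) i hi
  have hBG : ∑ i, B i • G i = 0 := by
    rw [← hb]
    refine (Fintype.sum_of_injective e he _ _ (fun i hi => by simp [hB0 i hi])
      fun j => by rw [hBe]).symm
  have hApos : 0 < ∑ i, α i := Finset.sum_pos (fun i _ => hα i) ⟨i₀, Finset.mem_univ _⟩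
  set β : ℝ := (∑ i, B i) / ∑ i, α i with hβ
  have hzero := affineIndependent_iff.mp hG Finset.univ (fun i => B i - β * α i)
    (by rw [Finset.sum_sub_distrib, ← Finset.mul_sum, hβ, div_mul_cancel₀ _ hApos.ne', sub_self])
    (by simp only [sub_smul, mul_smul, Finset.sum_sub_distrib, ← Finset.smul_sum, hBG, hsum,
          smul_zero, sub_zero])
  have hβ0 : β = 0 := by
    have := hzero i₀ (Finset.mem_univ _)
    rw [hB0 i₀ hi₀] at this
    simpa [(hα i₀).ne'] using this
  simpa [hβ0, hBe] using hzero (e j) (Finset.mem_univ _)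

end QuasiNewtonLimit

section Selection

variable {n m : ℕ} {f : Euc n → ℝ} {φ : Fin m → Euc n → ℝ}

/-- Near any point, `f` is a selection of its essentially active functions. -/
lemma A1.eventually_exists_mem_Ie (h : A1 f φ) (x : Euc n) :
    ∀ᶠ y in 𝓝 x, ∃ i ∈ Ie f φ x, f y = φ i y := by
  set A : Fin m → Set (Euc n) := fun i => {y | f y = φ i y} with hA
  have hclosed : ∀ i, IsClosed (A i) := fun i => isClosed_eq h.1 (h.2.2 i).1.continuous
  have hcover : ⋃ i, closure (interior (A i)) = Set.univ := by
    rw [← closure_iUnion_of_finite]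
    exact (dense_iUnion_interior_of_closed hclosed
      (Set.eq_univ_of_forall fun y => Set.mem_iUnion.mpr (h.2.1 y))).closure_eq
  have hfar : ∀ᶠ y in 𝓝 x, ∀ i, i ∉ Ie f φ x → y ∉ closure (interior (A i)) :=
    eventually_all.mpr fun i => by
      by_cases hi : i ∈ Ie f φ x
      · simp [hi]
      · filter_upwards [isClosed_closure.isOpen_compl.mem_nhds hi] with y hy _ using hy
  filter_upwards [hfar] with y hy
  obtain ⟨i, hi⟩ := Set.mem_iUnion.mp (hcover.ge (Set.mem_univ y))
  exact ⟨i, by_contra fun hn => hy i hn hi,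
    closure_minimal interior_subset (hclosed i) hi⟩

/-- At a point of differentiability, the gradient of `f` is the gradient of some essentially
active selection function. -/
lemma A1.nonempty_Ig (h : A1 f φ) {x : Euc n} (hf : DifferentiableAt ℝ f x) :
    (Ig f φ x).Nonempty := by
  by_contra hempty
  have hne : ∀ i : Ie f φ x, gradient f x - gradient (φ i) x ≠ 0 := fun i hi =>
    hempty ⟨i, i.2, sub_eq_zero.mp hi⟩
  obtain ⟨v, hv⟩ := Module.Dual.exists_forall_ne_zero_of_forall_exists
    (fun i : Ie f φ x => innerₛₗ ℝ (gradient f x - gradient (φ i) x))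
    (fun i => ⟨_, fun h0 => hne i (inner_self_eq_zero.mp h0)⟩)
  have hline : ∀ {ψ : Euc n → ℝ}, DifferentiableAt ℝ ψ x →
      HasDerivAt (fun s : ℝ => ψ (x + s • v)) ⟪gradient ψ x, v⟫ 0 := fun {ψ} hψ => by
    have hl : HasDerivAt (fun s : ℝ => x + s • v) v 0 := by
      simpa using ((hasDerivAt_id (0 : ℝ)).smul_const v).const_add x
    have hψ' : HasFDerivAt ψ (InnerProductSpace.toDual ℝ (Euc n) (gradient ψ x))
        (x + (0 : ℝ) • v) := by
      simpa using hψ.hasGradientAt.hasFDerivAt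
    exact hψ'.comp_hasDerivAt 0 hl
  have hdiff : ∀ᶠ s in 𝓝[≠] (0 : ℝ), ∀ i : Ie f φ x, f (x + s • v) - φ i (x + s • v) ≠ 0 :=
    eventually_all.mpr fun i =>
      ((hline hf).sub (hline ((h.2.2 i).1.differentiable one_ne_zero x))).eventually_ne
        (by rw [← inner_sub_left]; exact hv i)
  have hcont : Tendsto (fun s : ℝ => x + s • v) (𝓝[≠] 0) (𝓝 x) := by
    have : Continuous fun s : ℝ => x + s • v := by fun_prop
    simpa using (this.tendsto 0).mono_left nhdsWithin_le_nhds
  obtain ⟨s, hs, i, hi, hfi⟩ := (hdiff.and (hcont.eventually (h.eventually_exists_mem_Ie x))).exists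
  exact hs ⟨i, hi⟩ (sub_eq_zero.mpr hfi)

/-- A continuous function with a unique global minimum and a bounded sublevel set has the minimum
as the limit of any minimizing family. -/
lemma A22.tendsto_of_le {xstar : Euc n} (h : A22 f xstar) (hf : Continuous f) {ι : Type*}
    {F : Filter ι} {u : ι → Euc n} {r : ι → ℝ} (hr : Tendsto r F (𝓝 (f xstar)))
    (hu : ∀ l, f (u l) ≤ r l) : Tendsto u F (𝓝 xstar) := by
  obtain ⟨hmin, z, hz, hbdd⟩ := h
  have hK : IsCompact {y | f y ≤ f z} :=
    Metric.isCompact_of_isClosed_isBounded (isClosed_le hf continuous_const) hbdd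
  have hev : ∀ᶠ l in F, u l ∈ {y | f y ≤ f z} :=
    (hr.eventually_lt_const (hmin z hz)).mono fun l hl => (hu l).trans hl.le
  rw [tendsto_iff_ultrafilter]
  intro U hU
  obtain ⟨a, -, ha⟩ := hK.ultrafilter_le_nhds (U.map u) (by
    rw [Ultrafilter.coe_map, le_principal_iff]
    exact hU hev)
  replace ha : Tendsto u U (𝓝 a) := ha
  have hle : f a ≤ f xstar :=
    le_of_tendsto_of_tendsto' ((hf.tendsto a).comp ha) (hr.mono_left hU) hu
  have : a = xstar := by_contra fun hne => (hmin a hne).not_ge hle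
  exact this ▸ ha

end Selection

/-- Theorem `thm:exploration`: under (A2) and Behavior (B2) for initial
points converging to `x*`, eventually each selection function is encountered within the
first `m` iterates. -/
theorem exploration {n m : ℕ} [NeZero m] (f : Euc n → ℝ) (φ : Fin m → Euc n → ℝ)
    (xstar : Euc n) (hA1 : A1 f φ) (hA21 : A21 φ xstar) (hA22 : A22 f xstar)
    (x : ℕ → ℕ → Euc n) (H : ℕ → ℕ → Matrix (Fin n) (Fin n) ℝ) (t : ℕ → ℕ → ℝ)
    (hinit : Tendsto (fun l => x l 0) atTop (𝓝 xstar))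
    (hB2 : B2 m f x H t) :
    ∃ N : ℕ, ∀ l > N, (⋃ k < m, Ig f φ (x l k)) = (Set.univ : Set (Fin m)) := by
  obtain ⟨c1, c2, σL, σU, hc1, -, hc2, hσL, hσLU, hB, hB22⟩ := hB2
  obtain ⟨⟨α, hα, hsum⟩, hind⟩ := hA21
  have hpos : ∀ l k, (Matrix.toEuclideanLin (H l k)).IsPositive := fun l k =>
    Matrix.isPositive_toEuclideanLin_iff.mpr ((hB l).2.1 k).2.posSemidef
  have hdesc : ∀ k < m, ∀ l, f (x l k) ≤ f (x l 0) := by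
    intro k
    induction k with
    | zero => exact fun _ _ => le_rfl
    | succ k ih =>
      intro hk l
      obtain ⟨hstep, ht, ⟨-, hW1, -⟩, -⟩ := (hB l).2.2.1 k (by omega)
      rw [← hstep, inner_neg_right] at hW1
      have hq : 0 ≤ ⟪gradient f (x l k), Matrix.toEuclideanLin (H l k) (gradient f (x l k))⟫ := by
        simpa using (hpos l k).inner_nonneg_right (gradient f (x l k))
      have := mul_nonneg (mul_nonneg hc1.le ht.le) hq
      linarith [ih (by omega) l]
  have hconv : ∀ k < m, Tendsto (fun l => x l k) atTop (𝓝 xstar) := fun k hk =>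
    hA22.tendsto_of_le hA1.1 ((hA1.1.tendsto xstar).comp hinit) (hdesc k hk)
  by_contra hcon
  have hfreq : ∃ᶠ l in atTop, (⋃ k < m, Ig f φ (x l k)) ≠ (Set.univ : Set (Fin m)) := by
    rw [frequently_atTop]
    intro N
    push Not at hcon
    obtain ⟨l, hl, hne⟩ := hcon N
    exact ⟨l, hl.le, hne⟩
  have hne : NeBot (atTop ⊓ 𝓟 {l | (⋃ k < m, Ig f φ (x l k)) ≠ (Set.univ : Set (Fin m))}) :=
    frequently_mem_iff_neBot.mp hfreq
  obtain ⟨U, hU'⟩ := Ultrafilter.exists_le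
    (atTop ⊓ 𝓟 {l | (⋃ k < m, Ig f φ (x l k)) ≠ (Set.univ : Set (Fin m))})
  obtain ⟨hU, hbad⟩ := le_inf_iff.mp hU'
  replace hbad : ∀ᶠ l in U, (⋃ k < m, Ig f φ (x l k)) ≠ (Set.univ : Set (Fin m)) :=
    le_principal_iff.mp hbad
  have hidx : ∀ k, ∃ i, k < m → ∀ᶠ l in U, i ∈ Ig f φ (x l k) := fun k => by
    by_cases hk : k < m
    · obtain ⟨i, hi⟩ := Ultrafilter.eventually_exists_iff.mp
        (Eventually.of_forall (f := (U : Filter ℕ)) fun l => hA1.nonempty_Ig ((hB l).1 k hk).1)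
      exact ⟨i, fun _ => hi⟩
    · exact ⟨0, fun h => absurd h hk⟩
  choose idx hidx using hidx
  have hgrad : ∀ k < m,
      Tendsto (fun l => gradient f (x l k)) U (𝓝 (gradient (φ (idx k)) xstar)) := fun k hk =>
    (((hA1.2.2 (idx k)).2.continuous.tendsto xstar).comp ((hconv k hk).mono_left hU)).congr'
      ((hidx k hk).mono fun l hl => hl.2.symm)
  have hnew : ∀ k < m, ∀ j < k, idx k ≠ idx j := by
    intro k
    induction k using Nat.strong_induction_on with
    | _ k ih =>
      intro hk j hj heq
      obtain ⟨k, rfl⟩ : ∃ k', k = k' + 1 := ⟨k - 1, by omega⟩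
      have hinj : Function.Injective fun i : Fin (k + 1) => idx i := by
        intro a b hab
        by_contra hne
        rcases lt_or_gt_of_ne (Fin.val_ne_of_ne hne) with hlt | hlt
        · exact ih b b.2 (by omega) a hlt hab.symm
        · exact ih a a.2 (by omega) b hlt hab
      obtain ⟨i₀, hi₀⟩ : ∃ i₀, i₀ ∉ Set.range fun i : Fin (k + 1) => idx i := by
        by_contra! hall
        have := Fintype.card_le_of_surjective (fun i : Fin (k + 1) => idx i) hall
        simp only [Fintype.card_fin] at this
        omega
      refine ne_of_curvature_condition U (k := k)
        (T := fun l => LinearMap.toContinuousLinearMap (Matrix.toEuclideanLin (H l k)))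
        (g := fun j l => gradient f (x l j)) (G := fun j => gradient (φ (idx j)) xstar)
        hσL (hσL.le.trans hσLU) hc2 (fun l => by simpa using ((hB l).2.1 k).2.posSemidef)
        (fun l => ((hB l).2.2.2 k (by omega)).1)
        (fun l => by
          rw [finrank_euclideanSpace_fin]
          exact ((hB l).2.2.2 k (by omega)).2)
        (fun i hi => hgrad i (by omega))
        (linearIndependent_comp_of_affineIndependent hind hα hsum hinj hi₀)
        (fun i hi => (hB22 k i (by omega) (by omega) hi).mono_left hU)
        (fun l => ?_) (Nat.lt_succ_iff.mp hj) (by simp only [heq])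
      obtain ⟨hstep, -, ⟨-, -, hW2⟩, -⟩ := (hB l).2.2.1 k (by omega)
      rw [← hstep] at hW2
      exact hW2
  have hinj : Function.Injective fun i : Fin m => idx i := by
    intro a b hab
    by_contra hne
    rcases lt_or_gt_of_ne (Fin.val_ne_of_ne hne) with hlt | hlt
    · exact hnew b b.2 a hlt hab.symm
    · exact hnew a a.2 b hlt hab
  have hgood : ∀ᶠ l in U, ∀ k : Fin m, idx k ∈ Ig f φ (x l k) :=
    eventually_all.mpr fun k => hidx k k.2
  obtain ⟨l, hl, hne⟩ := (hgood.and hbad).exists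
  refine hne (Set.eq_univ_of_forall fun i => ?_)
  obtain ⟨k, rfl⟩ := Finite.surjective_of_injective hinj i
  exact Set.mem_iUnion₂.mpr ⟨k, k.2, hl k⟩
end
end
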